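/- Let α ∈ (1,2), C_α > 0 and let g : [0,∞) → [0,1] be any function with values in [0,1]. Then there exists a constant c₃ > 0, independent of g, such that for all u > 0 and all x, x̃ ∈ ℝ with |x − x̃| ≥ 2u: ∫_{{z > 0 : u ≤ |x + z − x̃| ≤ 2u}} [ (1 − g(|x + z − x̃|/u))·u + g(|x + z − x̃|/u)·|x + z − x̃| − |x − x̃| − σ·z ] ν_α(dz) ≤ 2·∫_{{z ≥ 3u}} z ν_α(dz) = c₃·u^{1−α}. -/

import Mathlib

open Set MeasureTheory

/-- The Lévy measure of a spectrally positive `α`-stable process: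
`ν_α(dz) = C_α z^{-(1+α)} 1_{z>0} dz`. -/
noncomputable def nuMeasure (Cα α : ℝ) : Measure ℝ :=
  (volume.restrict (Ioi (0 : ℝ))).withDensity fun z => ENNReal.ofReal (Cα * z ^ (-(1 + α)))

/-- `σ = (x - x̃)/|x - x̃|` for `x ≠ x̃`, and `σ = 1` for `x = x̃`. -/
noncomputable def sgn' (x xt : ℝ) : ℝ := if x = xt then 1 else (x - xt) / |x - xt|

lemma nuMeasure_restrict_Ici (Cα α : ℝ) {a : ℝ} (ha : 0 < a) :
    (nuMeasure Cα α).restrict (Ici a) =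
      (volume.restrict (Ioi a)).withDensity fun z => ENNReal.ofReal (Cα * z ^ (-(1 + α))) := by
  have h : Ici a ∩ Ioi 0 = Ici a := inter_eq_left.2 fun z hz => lt_of_lt_of_le ha hz
  rw [nuMeasure, restrict_withDensity measurableSet_Ici,
    Measure.restrict_restrict measurableSet_Ici, h, ← Measure.restrict_congr_set Ioi_ae_eq_Ici]

lemma mul_toReal_density {Cα α z : ℝ} (hC : 0 < Cα) (hz : 0 < z) :
    z * (ENNReal.ofReal (Cα * z ^ (-(1 + α)))).toReal = Cα * z ^ (-α) := by
  rw [ENNReal.toReal_ofReal (by positivity), mul_left_comm]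
  nth_rewrite 1 [← Real.rpow_one z]
  rw [← Real.rpow_add hz]
  congr 2
  ring

lemma integrableOn_id_nuMeasure {Cα α a : ℝ} (hα : 1 < α) (hC : 0 < Cα) (ha : 0 < a) :
    IntegrableOn (fun z => z) (Ici a) (nuMeasure Cα α) := by
  rw [IntegrableOn, nuMeasure_restrict_Ici Cα α ha,
    integrable_withDensity_iff (by fun_prop) (by simp)]
  have h : IntegrableOn (fun z : ℝ => Cα * z ^ (-α)) (Ioi a) :=
    (integrableOn_Ioi_rpow_of_lt (by linarith) ha).const_mul Cα
  exact h.congr_fun (fun z hz => (mul_toReal_density hC (ha.trans hz)).symm) measurableSet_Ioi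

lemma setIntegral_id_nuMeasure {Cα α a : ℝ} (hα : 1 < α) (hC : 0 < Cα) (ha : 0 < a) :
    ∫ z in Ici a, z ∂(nuMeasure Cα α) = Cα * a ^ (1 - α) / (α - 1) := by
  rw [nuMeasure_restrict_Ici Cα α ha,
    integral_withDensity_eq_integral_toReal_smul (by fun_prop) (by simp)]
  have h : ∀ z ∈ Ioi a, (ENNReal.ofReal (Cα * z ^ (-(1 + α)))).toReal • z = Cα * z ^ (-α) :=
    fun z hz => by rw [smul_eq_mul, mul_comm, mul_toReal_density hC (ha.trans hz)]
  rw [setIntegral_congr_fun measurableSet_Ioi h, integral_const_mul,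
    integral_Ioi_rpow_of_lt (by linarith) ha]
  have h1 : α - 1 ≠ 0 := by linarith
  have h2 : -α + 1 ≠ 0 := by linarith
  rw [show -α + 1 = -(α - 1) by ring, show 1 - α = -(α - 1) by ring]
  field_simp

lemma ae_pos_nuMeasure (Cα α : ℝ) : ∀ᵐ z ∂(nuMeasure Cα α), 0 < z :=
  (withDensity_absolutelyContinuous _ _).ae_le (ae_restrict_mem measurableSet_Ioi)

/-- Pointwise bound on the integrand, with `t` the value of `g`. -/
lemma integrand_le_indicator {t u x xt z : ℝ} (ht : t ∈ Icc (0 : ℝ) 1) (hu : 0 < u)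
    (hx : 2 * u ≤ |x - xt|) (hz : 0 < z) (h₁ : u ≤ |x + z - xt|) (h₂ : |x + z - xt| ≤ 2 * u) :
    (1 - t) * u + t * |x + z - xt| - |x - xt| - sgn' x xt * z
      ≤ (Ici (3 * u)).indicator (fun z => 2 * z) z := by
  have hconv : (1 - t) * u + t * |x + z - xt| ≤ |x + z - xt| := by
    nlinarith [mul_nonneg (sub_nonneg.2 ht.2) (sub_nonneg.2 h₁)]
  rcases le_total 0 (x - xt) with hd | hd
  · rw [abs_of_nonneg hd] at hx
    rw [abs_of_nonneg (by linarith)] at h₂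
    linarith
  · rw [abs_of_nonpos hd] at hx ⊢
    have hσ : sgn' x xt = -1 := by
      rw [sgn', if_neg (by intro h; linarith), abs_of_nonpos hd, div_neg,
        div_self (by intro h; linarith)]
    rw [hσ]
    rcases le_total 0 (x + z - xt) with hy | hy
    · rw [abs_of_nonneg hy] at *
      rw [indicator_of_mem (show z ∈ Ici (3 * u) from mem_Ici.2 (by linarith))]
      linarith
    · have h0 : 0 ≤ (Ici (3 * u)).indicator (fun z => 2 * z) z :=
        indicator_apply_nonneg fun _ => by linarith
      rw [abs_of_nonpos hy] at *
      linarith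

/-- Estimate \eqref{W3} on `I₃`: there is `c₃ > 0`, independent of the
`[0,1]`-valued function `g`, such that for all `u > 0` and `x, x̃` with
`|x - x̃| ≥ 2u`,
`∫_{u ≤ |x+z-x̃| ≤ 2u} [(1 - g(|x+z-x̃|/u)) u + g(|x+z-x̃|/u)|x+z-x̃| - |x-x̃| - σ z] ν_α(dz)
  ≤ 2 ∫_{z ≥ 3u} z ν_α(dz) = c₃ u^{1-α}`. -/
theorem stmt9 (α Cα : ℝ) (hα : α ∈ Ioo (1 : ℝ) 2) (hCα : 0 < Cα) :
    ∃ c₃ : ℝ, 0 < c₃ ∧ ∀ g : ℝ → ℝ, (∀ r : ℝ, 0 ≤ r → g r ∈ Icc (0 : ℝ) 1) →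
      ∀ u x xt : ℝ, 0 < u → 2 * u ≤ |x - xt| →
        (∫ z in {z : ℝ | u ≤ |x + z - xt| ∧ |x + z - xt| ≤ 2 * u},
            ((1 - g (|x + z - xt| / u)) * u + g (|x + z - xt| / u) * |x + z - xt|
              - |x - xt| - sgn' x xt * z) ∂(nuMeasure Cα α))
          ≤ 2 * (∫ z in Ici (3 * u), z ∂(nuMeasure Cα α)) ∧
        2 * (∫ z in Ici (3 * u), z ∂(nuMeasure Cα α)) = c₃ * u ^ (1 - α) := by
  obtain ⟨hα₁, -⟩ := hα
  have hα' : 0 < α - 1 := by linarith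
  refine ⟨2 * (Cα * 3 ^ (1 - α) / (α - 1)), by positivity, fun g hg u x xt hu hx => ⟨?_, ?_⟩⟩
  · set S := {z : ℝ | u ≤ |x + z - xt| ∧ |x + z - xt| ≤ 2 * u}
    have hS : MeasurableSet S :=
      measurableSet_Icc.preimage (f := fun z => |x + z - xt|) (by fun_prop)
    have hu3 : 0 < 3 * u := by linarith
    by_cases hint : IntegrableOn (fun z => (1 - g (|x + z - xt| / u)) * u
        + g (|x + z - xt| / u) * |x + z - xt| - |x - xt| - sgn' x xt * z) S (nuMeasure Cα α)
    · rw [← integral_const_mul, ← integral_indicator hS, ← integral_indicator measurableSet_Ici]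
      refine integral_mono_ae (hint.integrable_indicator hS)
        (IntegrableOn.integrable_indicator
          ((integrableOn_id_nuMeasure hα₁ hCα hu3).const_mul 2) measurableSet_Ici) ?_
      filter_upwards [ae_pos_nuMeasure Cα α] with z hz
      by_cases hzS : z ∈ S
      · rw [indicator_of_mem hzS]
        exact integrand_le_indicator (hg _ (by positivity)) hu hx hz hzS.1 hzS.2
      · rw [indicator_of_notMem hzS]
        exact indicator_apply_nonneg fun _ => by linarith
    · rw [integral_undef hint, setIntegral_id_nuMeasure hα₁ hCα hu3]
      positivity
  · rw [setIntegral_id_nuMeasure hα₁ hCα (by linarith), Real.mul_rpow (by norm_num) hu.le]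
    ring
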